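/- Let F ∈ ℂ[x,y] be a nonzero binary form of degree d ≥ 2 that is not of the form L·M^{d−1} for linear forms L, M (equivalently, F has less than maximal Waring rank, rk(F) < d). Then there exists a nonzero linear differential operator ∂ ∈ ℂ[X,Y]_1 such that rk(∂∘F) = rk(F). -/

import Mathlib

open MvPolynomial

noncomputable section

/-- The linear form `c₀x₀ + ⋯ + cₙxₙ` with coefficient vector `c`. -/
def lin {σ : Type*} [Fintype σ] (c : σ → ℂ) : MvPolynomial σ ℂ :=
  ∑ i, C (c i) * X i

/-- `F` admits a Waring decomposition `F = L₁^d + ⋯ + L_r^d`. -/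
def HasWaringDecomp {σ : Type*} [Fintype σ] (d : ℕ) (F : MvPolynomial σ ℂ) (r : ℕ) : Prop :=
  ∃ L : Fin r → σ → ℂ, F = ∑ j, lin (L j) ^ d

/-- The Waring rank of `F` (as a form of degree `d`). -/
def waringRank {σ : Type*} [Fintype σ] (d : ℕ) (F : MvPolynomial σ ℂ) : ℕ :=
  sInf {r | HasWaringDecomp d F r}

/-- The linear form with coefficient vector `a` lies in the Waring locus of `F`:
there are linear forms `L₂, …, L_r` with `r = rk F` such that `F` lies in the
`ℂ`-linear span of `L^d, L₂^d, …, L_r^d`. -/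
def InWaringLocus {σ : Type*} [Fintype σ] (d : ℕ) (F : MvPolynomial σ ℂ) (a : σ → ℂ) : Prop :=
  ∃ (c : Fin (waringRank d F) → ℂ) (L : Fin (waringRank d F) → σ → ℂ)
    (j₀ : Fin (waringRank d F)), L j₀ = a ∧ F = ∑ j, c j • lin (L j) ^ d


/-! ### Univariate model: forms of degree `n` as polynomials of `natDegree ≤ n` -/

/-- Evaluation of a form of degree `n` at a point of the projective line. -/
def ev (n : ℕ) : Option ℂ → (Polynomial ℂ →ₗ[ℂ] ℂ)
  | none => Polynomial.lcoeff ℂ n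
  | some a => Polynomial.leval a

theorem ev_none (n : ℕ) (q : Polynomial ℂ) : ev n none q = q.coeff n := rfl
theorem ev_some (n : ℕ) (a : ℂ) (q : Polynomial ℂ) : ev n (some a) q = q.eval a := rfl

theorem ev_mul {n m k : ℕ} (hk : n + m = k) (p : Option ℂ) (f g : Polynomial ℂ)
    (hf : f.natDegree ≤ n) (hg : g.natDegree ≤ m) :
    ev k p (f * g) = ev n p f * ev m p g := by
  subst hk
  cases p with
  | none => simpa [ev_none] using Polynomial.coeff_mul_add_eq_of_natDegree_le hf hg
  | some a => simp [ev_some]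

/-- `g`, as a form of degree `e`, is apolar to the functional `φ` on forms of degree `d`. -/
def Kills (d : ℕ) (φ : Polynomial ℂ →ₗ[ℂ] ℂ) (e : ℕ) (g : Polynomial ℂ) : Prop :=
  g.natDegree ≤ e ∧ ∀ q : Polynomial ℂ, q.natDegree + e ≤ d → φ (g * q) = 0

def Dec (d : ℕ) (φ : Polynomial ℂ →ₗ[ℂ] ℂ) (P : Finset (Option ℂ)) (c : Option ℂ → ℂ) : Prop :=
  ∀ q : Polynomial ℂ, q.natDegree ≤ d → φ q = ∑ p ∈ P, c p * ev d p q

def URep (d : ℕ) (φ : Polynomial ℂ →ₗ[ℂ] ℂ) (r : ℕ) : Prop :=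
  ∃ P : Finset (Option ℂ), P.card ≤ r ∧ ∃ c, Dec d φ P c

theorem exists_lin_vanish (p : Option ℂ) :
    ∃ l : Polynomial ℂ, l ≠ 0 ∧ l.natDegree ≤ 1 ∧ ev 1 p l = 0 ∧
      ∀ p', p' ≠ p → ev 1 p' l ≠ 0 := by
  cases p with
  | none =>
    refine ⟨1, one_ne_zero, by simp, by simp [ev_none, Polynomial.coeff_one], ?_⟩
    intro p' hp'
    cases p' with
    | none => exact absurd rfl hp'
    | some b => simp [ev_some]
  | some a =>
    refine ⟨Polynomial.X - Polynomial.C a, Polynomial.X_sub_C_ne_zero a, by simp,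
      by simp [ev_some], ?_⟩
    intro p' hp'
    cases p' with
    | none => simp [ev_none, Polynomial.coeff_C]
    | some b =>
      simp only [ev_some, Polynomial.eval_sub, Polynomial.eval_X, Polynomial.eval_C]
      intro h
      exact hp' (by rw [sub_eq_zero.mp h])

theorem separator (P : Finset (Option ℂ)) : ∀ (n : ℕ) (p0 : Option ℂ), p0 ∉ P → P.card ≤ n →
    ∃ q : Polynomial ℂ, q.natDegree ≤ n ∧ ev n p0 q ≠ 0 ∧ ∀ p ∈ P, ev n p q = 0 := by
  induction P using Finset.induction_on with
  | empty =>
    intro n p0 _ _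
    cases p0 with
    | none => exact ⟨Polynomial.X ^ n, by simp, by simp [ev_none], by simp⟩
    | some a => exact ⟨1, by simp, by simp [ev_some], by simp⟩
  | insert p P hp ih =>
    intro n p0 hp0 hn
    rw [Finset.card_insert_of_notMem hp] at hn
    rw [Finset.mem_insert, not_or] at hp0
    obtain ⟨q, hq, hq0, hqP⟩ := ih (n - 1) p0 hp0.2 (by omega)
    obtain ⟨l, _, hl1, hlp, hl⟩ := exists_lin_vanish p
    have key : ∀ p', ev n p' (q * l) = ev (n - 1) p' q * ev 1 p' l := fun p' =>
      ev_mul (by omega) p' q l hq hl1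
    refine ⟨q * l, ?_, ?_, ?_⟩
    · have := Polynomial.natDegree_mul_le (p := q) (q := l)
      omega
    · rw [key]; exact mul_ne_zero hq0 (hl p0 hp0.1)
    · intro p' hp'
      rw [key]
      rcases Finset.mem_insert.mp hp' with h | h
      · rw [h, hlp, mul_zero]
      · rw [hqP p' h, zero_mul]

/-- Independence of powers. -/
theorem dec_vanish {d e : ℕ} {φ : Polynomial ℂ →ₗ[ℂ] ℂ} {P : Finset (Option ℂ)}
    {c : Option ℂ → ℂ} (h : Dec d φ P c) {u : Polynomial ℂ} (hu : Kills d φ e u)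
    (hP : P.card + e ≤ d + 1) : ∀ p ∈ P, c p * ev e p u = 0 := by
  intro p0 hp0
  have hc := Finset.card_erase_add_one hp0
  obtain ⟨q, hq, hq0, hqP⟩ := separator (P.erase p0) (d - e) p0 (by simp) (by omega)
  have h1 := hu.2 q (by omega)
  have hdeg := Polynomial.natDegree_mul_le (p := u) (q := q)
  have := hu.1
  rw [h (u * q) (by omega), Finset.sum_eq_single p0] at h1
  · rw [ev_mul (n := e) (m := d - e) (by omega) p0 u q hu.1 hq, ← mul_assoc] at h1
    exact (mul_eq_zero.mp h1).resolve_right hq0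
  · intro p hp hpp
    rw [ev_mul (n := e) (m := d - e) (by omega) p u q hu.1 hq,
      hqP p (Finset.mem_erase.mpr ⟨hpp, hp⟩)]
    simp
  · intro h'; exact absurd hp0 h'

theorem kills_of_vanish {d e : ℕ} {φ : Polynomial ℂ →ₗ[ℂ] ℂ} {P : Finset (Option ℂ)}
    {c : Option ℂ → ℂ} (h : Dec d φ P c) {w : Polynomial ℂ} (hw : w.natDegree ≤ e)
    (hv : ∀ p ∈ P, c p * ev e p w = 0) : Kills d φ e w := by
  refine ⟨hw, fun q hq => ?_⟩
  have hdeg := Polynomial.natDegree_mul_le (p := w) (q := q)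
  rw [h (w * q) (by omega)]
  refine Finset.sum_eq_zero fun p hp => ?_
  rw [ev_mul (n := e) (m := d - e) (by omega) p w q hw (by omega), ← mul_assoc, hv p hp, zero_mul]

theorem duality {ι : Type} [Fintype ι] (n : ℕ) (L : ι → (Polynomial ℂ →ₗ[ℂ] ℂ))
    (K : Polynomial ℂ →ₗ[ℂ] ℂ)
    (h : ∀ q : Polynomial ℂ, q.natDegree ≤ n → (∀ i, L i q = 0) → K q = 0) :
    ∃ c : ι → ℂ, ∀ q : Polynomial ℂ, q.natDegree ≤ n → K q = ∑ i, c i * L i q := by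
  have := mem_span_of_iInf_ker_le_ker
    (L := fun i => (L i).domRestrict (Polynomial.degreeLE ℂ n))
    (K := K.domRestrict (Polynomial.degreeLE ℂ n)) (by
      intro x hx
      simp only [Submodule.mem_iInf, LinearMap.mem_ker, LinearMap.domRestrict_apply] at hx ⊢
      exact h x (Polynomial.natDegree_le_iff_degree_le.mpr (Polynomial.mem_degreeLE.mp x.2)) hx)
  obtain ⟨c, hc⟩ := (Submodule.mem_span_range_iff_exists_fun ℂ).1 this
  refine ⟨c, fun q hq => ?_⟩
  have := congrArg (fun f => f ⟨q, Polynomial.mem_degreeLE.mpr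
    (Polynomial.natDegree_le_iff_degree_le.mp hq)⟩) hc
  simp only [LinearMap.sum_apply, LinearMap.smul_apply, LinearMap.domRestrict_apply,
    smul_eq_mul] at this
  exact this.symm

/-- Sylvester: a squarefree apolar form gives a decomposition. -/
theorem urep_of_kills {d m : ℕ} {φ : Polynomial ℂ →ₗ[ℂ] ℂ} {g : Polynomial ℂ}
    (hd : 1 ≤ d) (hg : Kills d φ m g) (hg0 : g ≠ 0) (hm : m ≤ g.natDegree + 1)
    (hr : g.roots.Nodup) : URep d φ m := by
  classical
  have hcard : g.roots.toFinset.card = g.natDegree := by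
    rw [Multiset.toFinset_card_of_nodup hr]
    exact (IsAlgClosed.splits g).natDegree_eq_card_roots.symm
  let R : Finset (Option ℂ) := g.roots.toFinset.map ⟨some, Option.some_injective _⟩
  let P : Finset (Option ℂ) := if m ≤ g.natDegree then R else insert none R
  have hRP : R ⊆ P := by
    intro x hx; simp only [P]; split_ifs
    · exact hx
    · exact Finset.mem_insert_of_mem hx
  have hPc : P.card ≤ m := by
    have hRc : R.card = g.natDegree := by simp only [R, Finset.card_map]; exact hcard
    have := hg.1
    simp only [P]; split_ifs with h
    · omega
    · have := Finset.card_insert_le none R; omega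
  obtain ⟨c, hc⟩ := duality (ι := P) d (fun p => ev d p.1) φ (by
    intro q hq hv
    by_cases hq0 : q = 0
    · simp [hq0]
    have hdvd : g ∣ q := by
      rw [IsAlgClosed.dvd_iff_roots_le_roots hg0 hq0, Multiset.le_iff_subset hr]
      intro a ha
      rw [Polynomial.mem_roots hq0]
      have := hv ⟨some a, hRP (by simpa [R] using ha)⟩
      simpa [ev_some] using this
    obtain ⟨w, rfl⟩ := hdvd
    refine hg.2 w ?_
    have hw0 : w ≠ 0 := right_ne_zero_of_mul hq0
    have hdeg := Polynomial.natDegree_mul hg0 hw0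
    by_cases h : m ≤ g.natDegree
    · omega
    · have hn := hv ⟨none, by simp only [P, if_neg h]; exact Finset.mem_insert_self _ _⟩
      simp only [ev_none] at hn
      have : (g * w).natDegree ≠ d := by
        intro hE
        rw [← hE] at hn
        exact hq0 (Polynomial.leadingCoeff_eq_zero.mp hn)
      omega)
  refine ⟨P, hPc, fun p => if h : p ∈ P then c ⟨p, h⟩ else 0, fun q hq => ?_⟩
  rw [hc q hq, ← Finset.sum_coe_sort P]
  refine Finset.sum_congr rfl fun p _ => ?_
  simp

/-- base-point freeness of the apolar system in degree `d + 2 - d₁`. -/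
theorem bpf {d d1 m : ℕ} {φ : Polynomial ℂ →ₗ[ℂ] ℂ} (h1 : 1 ≤ d1) (hm : d1 + m = d + 2)
    (hm1 : 1 ≤ m) (hmin : ∀ g, Kills d φ (d1 - 1) g → g = 0) (p : Option ℂ) :
    ∃ h, Kills d φ m h ∧ ev m p h ≠ 0 := by
  by_contra! hcon
  obtain ⟨c, hc⟩ := duality (ι := Fin (d1 - 1)) m
    (fun j => φ ∘ₗ LinearMap.mulRight ℂ (Polynomial.X ^ (j : ℕ))) (ev m p) (by
      intro h hh hv
      refine hcon h ⟨hh, fun q hq => ?_⟩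
      rw [Polynomial.as_sum_range_C_mul_X_pow q, Finset.mul_sum, map_sum]
      refine Finset.sum_eq_zero fun j hj => ?_
      rw [Finset.mem_range] at hj
      have := hv ⟨j, by omega⟩
      simp only [LinearMap.comp_apply, LinearMap.mulRight_apply] at this
      rw [mul_left_comm, ← Polynomial.smul_eq_C_mul, map_smul, this, smul_zero])
  let q : Polynomial ℂ := ∑ j : Fin (d1 - 1), Polynomial.C (c j) * Polynomial.X ^ (j : ℕ)
  have hK : ∀ h : Polynomial ℂ, h.natDegree ≤ m → ev m p h = φ (h * q) := by
    intro h hh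
    rw [hc h hh]
    simp only [q, Finset.mul_sum, map_sum]
    refine Finset.sum_congr rfl fun j _ => ?_
    simp only [LinearMap.comp_apply, LinearMap.mulRight_apply]
    rw [mul_left_comm, ← Polynomial.smul_eq_C_mul, map_smul, smul_eq_mul]
  have hqd : q.natDegree ≤ d1 - 2 := by
    refine Polynomial.natDegree_sum_le_of_forall_le _ _ fun j _ => ?_
    refine (Polynomial.natDegree_C_mul_X_pow_le _ _).trans ?_
    have := j.2
    omega
  obtain ⟨l, hl0, hl1, hlp, _⟩ := exists_lin_vanish p
  have hlq : l * q = 0 := by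
    by_cases hd1 : d1 = 1
    · subst hd1
      simp [q]
    refine hmin _ ⟨?_, ?_⟩
    · have := Polynomial.natDegree_mul_le (p := l) (q := q)
      omega
    · intro h hh
      have := Polynomial.natDegree_mul_le (p := l) (q := h)
      rw [show l * q * h = (l * h) * q by ring, ← hK _ (by omega),
        ev_mul (n := 1) (m := m - 1) (by omega) p l h hl1 (by omega), hlp, zero_mul]
  have hq0 : q = 0 := (mul_eq_zero.mp hlq).resolve_left hl0
  obtain ⟨h, hh, hh0, _⟩ := separator ∅ m p (by simp) (by simp)
  apply hh0
  rw [hK h hh, hq0, mul_zero, map_zero]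

/-- The apolar forms of degree `e` as a subspace. -/
def killSub (d : ℕ) (φ : Polynomial ℂ →ₗ[ℂ] ℂ) (e : ℕ) : Submodule ℂ (Polynomial ℂ) where
  carrier := {g | Kills d φ e g}
  add_mem' := by
    intro a b ha hb
    refine ⟨(Polynomial.natDegree_add_le a b).trans (max_le ha.1 hb.1), fun q hq => ?_⟩
    rw [add_mul, map_add, ha.2 q hq, hb.2 q hq, add_zero]
  zero_mem' := ⟨by simp, by simp⟩
  smul_mem' := by
    intro c a ha
    refine ⟨(Polynomial.natDegree_smul_le c a).trans ha.1, fun q hq => ?_⟩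
    rw [smul_mul_assoc, map_smul, ha.2 q hq, smul_zero]

/-- A base point free system contains two coprime elements, one of exact degree `m`. -/
theorem coprime_pair {m : ℕ} (hm : 1 ≤ m) (V : Submodule ℂ (Polynomial ℂ))
    (hV : ∀ g ∈ V, g.natDegree ≤ m) (hb : ∀ p, ∃ h ∈ V, ev m p h ≠ 0) :
    ∃ f ∈ V, ∃ g ∈ V, f.natDegree = m ∧ f.coeff m ≠ 0 ∧ ∀ a, f.eval a = 0 → g.eval a ≠ 0 := by
  classical
  obtain ⟨f, hf, hf0⟩ := hb none
  have hfc : f.coeff m ≠ 0 := hf0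
  have hfn : f ≠ 0 := by rintro rfl; simp at hfc
  obtain ⟨g, hg, hgr⟩ := Module.Dual.exists_forall_mem_ne_zero_of_forall_exists V
    (fun a : f.roots.toFinset => ev m (some a.1)) (fun a => hb _)
  refine ⟨f, hf, g, hg, le_antisymm (hV f hf) (Polynomial.le_natDegree_of_ne_zero hfc), hfc, ?_⟩
  intro a ha
  exact hgr ⟨a, by simpa [hfn] using ha⟩

theorem bertini {m : ℕ} (hm : 1 ≤ m) (V : Submodule ℂ (Polynomial ℂ))
    (hV : ∀ g ∈ V, g.natDegree ≤ m) (hb : ∀ p, ∃ h ∈ V, ev m p h ≠ 0) :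
    ∃ h ∈ V, h ≠ 0 ∧ m ≤ h.natDegree ∧ h.roots.Nodup := by
  classical
  obtain ⟨f, hf, g, hg, hfd, hfc, hco⟩ := coprime_pair hm V hV hb
  have hfn : f ≠ 0 := by rintro rfl; simp at hfc
  set W := g * f.derivative - g.derivative * f with hW
  have hW0 : W ≠ 0 := by
    intro h0
    have hcop : IsCoprime f g := by
      rw [Polynomial.isCoprime_iff_aeval_ne_zero_of_isAlgClosed ℂ ℂ]
      intro a
      by_cases ha : f.eval a = 0
      · right; simpa using hco a ha
      · left; simpa using ha
    have h1 : f ∣ g * f.derivative := ⟨g.derivative, by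
      rw [mul_comm f]; exact sub_eq_zero.mp h0⟩
    have h2 : f ∣ f.derivative := hcop.dvd_of_dvd_mul_left h1
    have h3 : f.derivative = 0 := by
      apply Polynomial.eq_zero_of_dvd_of_natDegree_lt h2
      apply Polynomial.natDegree_derivative_lt
      omega
    have := Polynomial.derivative_eq_zero.mp h3
    omega
  obtain ⟨s, hs⟩ := Infinite.exists_notMem_finset
    (insert (-g.coeff m / f.coeff m) (W.roots.toFinset.image fun a => -g.eval a / f.eval a))
  rw [Finset.mem_insert, not_or] at hs
  have hc : (g + s • f).coeff m ≠ 0 := by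
    simp only [Polynomial.coeff_add, Polynomial.coeff_smul, smul_eq_mul]
    intro h
    apply hs.1
    rw [eq_div_iff hfc]
    linear_combination h
  have hn : g + s • f ≠ 0 := by intro h; rw [h] at hc; simp at hc
  refine ⟨g + s • f, V.add_mem hg (V.smul_mem s hf), hn, Polynomial.le_natDegree_of_ne_zero hc, ?_⟩
  rw [Multiset.nodup_iff_count_le_one]
  intro a
  by_contra! hcount
  rw [Polynomial.count_roots, Polynomial.one_lt_rootMultiplicity_iff_isRoot hn] at hcount
  obtain ⟨hr, hr'⟩ := hcount
  simp only [Polynomial.IsRoot, Polynomial.eval_add, Polynomial.eval_smul, smul_eq_mul,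
    Polynomial.derivative_add, Polynomial.derivative_smul] at hr hr'
  have hfa : f.eval a ≠ 0 := by
    intro h
    apply hco a h
    rw [h] at hr; simpa using hr
  apply hs.2
  rw [Finset.mem_image]
  refine ⟨a, ?_, ?_⟩
  · rw [Multiset.mem_toFinset, Polynomial.mem_roots hW0]
    simp only [hW, Polynomial.IsRoot, Polynomial.eval_sub, Polynomial.eval_mul]
    linear_combination f.derivative.eval a * hr - f.eval a * hr'
  · rw [div_eq_iff hfa]; linear_combination -hr

/-- A base point free system with `m ≥ 2` contains a non-squarefree member. -/
theorem ramified {m : ℕ} (hm : 2 ≤ m) (V : Submodule ℂ (Polynomial ℂ))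
    (hV : ∀ g ∈ V, g.natDegree ≤ m) (hb : ∀ p, ∃ h ∈ V, ev m p h ≠ 0) :
    ∃ l k : Polynomial ℂ, l.natDegree ≤ 1 ∧ k.natDegree + 2 ≤ m ∧ l ^ 2 * k ≠ 0 ∧
      l ^ 2 * k ∈ V := by
  obtain ⟨f, hf, g', hg', hfd, hfc, hco'⟩ := coprime_pair (by omega) V hV hb
  obtain ⟨g, hgdef⟩ : ∃ g, g = g' - (g'.coeff m / f.coeff m) • f := ⟨_, rfl⟩
  have hg : g ∈ V := hgdef ▸ V.sub_mem hg' (V.smul_mem _ hf)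
  have hgm : g.coeff m = 0 := by
    rw [hgdef]; simp [hfc]
  have hco : ∀ a, f.eval a = 0 → g.eval a ≠ 0 := by
    intro a ha
    rw [hgdef]; simpa [ha] using hco' a ha
  have hg0 : g ≠ 0 := by
    rintro rfl
    obtain ⟨a, ha⟩ := IsAlgClosed.exists_root f (by
      intro h; have := Polynomial.natDegree_eq_zero_iff_degree_le_zero.mpr h.le; omega)
    exact hco a ha (by simp)
  have hgd : g.natDegree ≤ m - 1 := by
    have h1 := hV g hg
    have : g.natDegree ≠ m := by
      intro h
      rw [← h] at hgm
      exact hg0 (Polynomial.leadingCoeff_eq_zero.mp hgm)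
    omega
  by_cases hg2 : g.natDegree + 2 ≤ m
  · exact ⟨1, g, by simp, hg2, by simpa using hg0, by simpa using hg⟩
  have hge : g.natDegree = m - 1 := by omega
  have hgc : g.coeff (m - 1) ≠ 0 := by
    rw [← hge]; exact Polynomial.leadingCoeff_ne_zero.mpr hg0
  set W := g * f.derivative - g.derivative * f with hW
  have hWc : W.coeff ((m - 1) + (m - 1)) ≠ 0 := by
    obtain ⟨n, rfl⟩ : ∃ n, m = n + 2 := ⟨m - 2, by omega⟩
    have e1 : (g * f.derivative).coeff ((n + 1) + (n + 1)) = g.coeff (n + 1) * f.derivative.coeff (n + 1) :=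
      Polynomial.coeff_mul_add_eq_of_natDegree_le (by simpa using hgd)
        ((Polynomial.natDegree_derivative_le f).trans (by omega))
    have e2 : (g.derivative * f).coeff (n + (n + 2)) = g.derivative.coeff n * f.coeff (n + 2) :=
      Polynomial.coeff_mul_add_eq_of_natDegree_le
        ((Polynomial.natDegree_derivative_le g).trans (by omega)) (by omega)
    have e3 : n + 2 - 1 = n + 1 := by omega
    rw [e3] at hgc ⊢
    rw [hW, Polynomial.coeff_sub, e1, show n + 1 + (n + 1) = n + (n + 2) by ring, e2,
      Polynomial.coeff_derivative, Polynomial.coeff_derivative]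
    have : g.coeff (n + 1) * (f.coeff (n + 1 + 1) * (((n + 1 : ℕ) : ℂ) + 1)) -
        g.coeff (n + 1) * ((n : ℂ) + 1) * f.coeff (n + 2) = g.coeff (n + 1) * f.coeff (n + 2) := by
      push_cast; ring
    rw [this]
    exact mul_ne_zero hgc hfc
  obtain ⟨a, ha⟩ := IsAlgClosed.exists_root W (by
    intro h
    have h1 := Polynomial.natDegree_eq_zero_iff_degree_le_zero.mpr h.le
    have h2 := Polynomial.le_natDegree_of_ne_zero hWc
    omega)
  obtain ⟨u, hu⟩ : ∃ u, u = f.eval a • g - g.eval a • f := ⟨_, rfl⟩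
  have huV : u ∈ V := hu ▸ V.sub_mem (V.smul_mem _ hg) (V.smul_mem _ hf)
  have hu0 : u ≠ 0 := by
    intro h
    have hga : g.eval a = 0 := by
      have := congrArg (fun x => Polynomial.coeff x m) (hu.symm.trans h)
      simpa [hgm, hfc] using this
    have hfa : f.eval a ≠ 0 := fun h' => hco a h' hga
    rw [hga, zero_smul, sub_zero, h] at hu
    exact hg0 ((smul_eq_zero.mp hu.symm).resolve_left hfa)
  have hmult : 1 < u.rootMultiplicity a := by
    rw [Polynomial.one_lt_rootMultiplicity_iff_isRoot hu0]
    simp only [hW, Polynomial.IsRoot, Polynomial.eval_sub, Polynomial.eval_mul] at ha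
    constructor
    · simp [hu]; ring
    · simp only [hu, Polynomial.IsRoot, Polynomial.derivative_sub, Polynomial.derivative_smul,
        Polynomial.eval_sub, Polynomial.eval_smul, smul_eq_mul]
      linear_combination -ha
  obtain ⟨k, hk⟩ := (Polynomial.le_rootMultiplicity_iff hu0).mp hmult
  refine ⟨Polynomial.X - Polynomial.C a, k, by simp, ?_, by rw [← hk]; exact hu0,
    by rw [← hk]; exact huV⟩
  have hk0 : k ≠ 0 := by rintro rfl; simp [hu0] at hk
  have h1 := hV u huV
  rw [hk, Polynomial.natDegree_mul (pow_ne_zero _ (Polynomial.X_sub_C_ne_zero a)) hk0,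
    Polynomial.natDegree_pow, Polynomial.natDegree_X_sub_C] at h1
  omega

theorem split_linear (n : ℕ) (k : Polynomial ℂ) (hk : k.natDegree ≤ n + 1) :
    ∃ l k' : Polynomial ℂ, l ≠ 0 ∧ l.natDegree ≤ 1 ∧ k'.natDegree ≤ n ∧ k = l * k' := by
  by_cases h : k.natDegree ≤ n
  · exact ⟨1, k, one_ne_zero, by simp, h, by simp⟩
  obtain ⟨a, ha⟩ := IsAlgClosed.exists_root k (by
    intro h'; have := Polynomial.natDegree_eq_zero_iff_degree_le_zero.mpr h'.le; omega)
  obtain ⟨k', rfl⟩ := Polynomial.dvd_iff_isRoot.mpr ha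
  refine ⟨_, k', Polynomial.X_sub_C_ne_zero a, by simp, ?_, rfl⟩
  have hk0 : k' ≠ 0 := by rintro rfl; simp at h
  rw [Polynomial.natDegree_mul (Polynomial.X_sub_C_ne_zero a) hk0,
    Polynomial.natDegree_X_sub_C] at hk
  omega

/-- The univariate main theorem. -/
theorem umain {d : ℕ} (hd : 2 ≤ d) (φ : Polynomial ℂ →ₗ[ℂ] ℂ)
    (h0 : ∃ q : Polynomial ℂ, q.natDegree ≤ d ∧ φ q ≠ 0)
    (hmax : ∀ l : Polynomial ℂ, l ≠ 0 → l.natDegree ≤ 1 → ¬ Kills d φ 2 (l ^ 2)) :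
    ∃ l : Polynomial ℂ, l ≠ 0 ∧ l.natDegree ≤ 1 ∧
      ∀ s, URep (d - 1) (φ ∘ₗ LinearMap.mulLeft ℂ l) s → URep d φ s := by
  classical
  have hex : ∃ e, ∃ g, Kills d φ e g ∧ g ≠ 0 :=
    ⟨d + 1, 1, ⟨by simp, fun q hq => by omega⟩, one_ne_zero⟩
  obtain ⟨d1, ⟨g, hg, hg0⟩, hmin'⟩ : ∃ d1, (∃ g, Kills d φ d1 g ∧ g ≠ 0) ∧
      ∀ e < d1, ∀ g, Kills d φ e g → g = 0 := by
    refine ⟨Nat.find hex, Nat.find_spec hex, fun e he g hg => ?_⟩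
    by_contra hne
    exact Nat.find_min hex he ⟨g, hg, hne⟩
  have hd1 : 1 ≤ d1 := by
    by_contra h
    have : d1 = 0 := by omega
    subst this
    obtain ⟨q, hq, hq0⟩ := h0
    have hgC := Polynomial.eq_C_of_natDegree_le_zero hg.1
    have := hg.2 q (by omega)
    rw [hgC, ← Polynomial.smul_eq_C_mul, map_smul] at this
    rcases smul_eq_zero.mp this with h | h
    · rw [h] at hgC; simp at hgC; exact hg0 hgC
    · exact hq0 h
  have hd1' : d1 ≤ d + 1 := by
    by_contra h
    exact one_ne_zero (hmin' (d + 1) (by omega) 1 ⟨by simp, fun q hq => by omega⟩)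
  obtain ⟨m, hm⟩ : ∃ m, d1 + m = d + 2 := ⟨d + 2 - d1, by omega⟩
  have hbpf := fun p => bpf (φ := φ) hd1 hm (by omega) (hmin' (d1 - 1) (by omega)) p
  have hle : d1 ≤ m := by
    by_contra h
    obtain ⟨h', hh, hh0⟩ := hbpf none
    rw [hmin' m (by omega) h' hh] at hh0
    simp at hh0
  have hup : URep d φ m := by
    obtain ⟨h, hh, hne, hmd, hr⟩ := bertini (by omega) (killSub d φ m) (fun g hg => hg.1) hbpf
    exact urep_of_kills (by omega) hh hne (by omega) hr
  by_cases hns : ∃ l k : Polynomial ℂ, l.natDegree ≤ 1 ∧ k.natDegree + 2 ≤ d1 ∧ l ^ 2 * k ≠ 0 ∧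
      Kills d φ d1 (l ^ 2 * k)
  · -- non-squarefree case
    obtain ⟨l, k, hl, hk, hlk, hkill⟩ := hns
    have hl0 : l ≠ 0 := by rintro rfl; simp at hlk
    have hd3 : 3 ≤ d1 := by
      by_contra h
      have h2 : d1 = 2 := by omega
      subst h2
      apply hmax l hl0 hl
      have hkC := Polynomial.eq_C_of_natDegree_le_zero (p := k) (by omega)
      have hk0 : k.coeff 0 ≠ 0 := by
        intro h; rw [h] at hkC; rw [hkC] at hlk; simp at hlk
      refine ⟨(Polynomial.natDegree_pow_le).trans (by omega), fun q hq => ?_⟩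
      have := hkill.2 q hq
      rw [hkC, mul_comm (l ^ 2), mul_assoc, ← Polynomial.smul_eq_C_mul, map_smul] at this
      exact (smul_eq_zero.mp this).resolve_left hk0
    obtain ⟨δ, k', hδ0, hδ, hk', rfl⟩ := split_linear (d1 - 3) k (by omega)
    refine ⟨δ, hδ0, hδ, fun s hs => ?_⟩
    obtain ⟨P, hPs, c, hc⟩ := hs
    by_cases hsm : m ≤ s
    · obtain ⟨Q, hQ, c', hc'⟩ := hup
      exact ⟨Q, hQ.trans hsm, c', hc'⟩
    exfalso
    have hdl2 := Polynomial.natDegree_pow_le (p := l) (n := 2)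
    have hd2 := Polynomial.natDegree_mul_le (p := l ^ 2) (q := k')
    have hd3' := Polynomial.natDegree_mul_le (p := l) (q := k')
    have hk1 : Kills (d - 1) (φ ∘ₗ LinearMap.mulLeft ℂ δ) (d1 - 1) (l ^ 2 * k') := by
      refine ⟨by omega, fun q hq => ?_⟩
      simp only [LinearMap.comp_apply, LinearMap.mulLeft_apply]
      rw [← hkill.2 q (by omega)]
      congr 1; ring
    have hv := dec_vanish hc hk1 (by omega)
    have hk2 := kills_of_vanish hc (w := l * k') (e := d1 - 2) (by omega) (by
      intro p hp
      have h1 := hv p hp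
      rw [pow_two, mul_assoc, ev_mul (n := 1) (m := d1 - 2) (by omega) p l _ hl (by omega)] at h1
      rcases mul_eq_zero.mp h1 with h | h
      · rw [h, zero_mul]
      rcases mul_eq_zero.mp h with h | h
      · rw [ev_mul (n := 1) (m := d1 - 3) (by omega) p l k' hl hk', h]; simp
      · rw [h, mul_zero])
    have hd4 := Polynomial.natDegree_mul_le (p := δ) (q := l * k')
    have := hmin' (d1 - 1) (by omega) (δ * (l * k')) ⟨by omega, fun q hq => by
      have := hk2.2 q (by omega)
      simp only [LinearMap.comp_apply, LinearMap.mulLeft_apply] at this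
      rw [mul_assoc]; exact this⟩
    apply hlk
    rw [show l ^ 2 * (δ * k') = l * (δ * (l * k')) by ring, this, mul_zero]
  · -- squarefree case
    have hlt : d1 < m := by
      by_contra h
      have : d1 = m := by omega
      subst this
      obtain ⟨l, k, h1, h2, h3, h4⟩ := ramified (by omega) (killSub d φ d1) (fun g hg => hg.1) hbpf
      exact hns ⟨l, k, h1, h2, h3, h4⟩
    have hgd : d1 ≤ g.natDegree + 1 := by
      by_contra h
      exact hns ⟨1, g, by simp, by omega, by simpa using hg0, by simpa using hg⟩
    have hnd : g.roots.Nodup := by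
      rw [Multiset.nodup_iff_count_le_one]
      intro a
      by_contra! hcount
      rw [Polynomial.count_roots] at hcount
      obtain ⟨k, hk⟩ := (Polynomial.le_rootMultiplicity_iff hg0).mp hcount
      have hk0 : k ≠ 0 := by rintro rfl; simp [hg0] at hk
      have h1 := hg.1
      rw [hk, Polynomial.natDegree_mul (pow_ne_zero _ (Polynomial.X_sub_C_ne_zero a)) hk0,
        Polynomial.natDegree_pow, Polynomial.natDegree_X_sub_C] at h1
      exact hns ⟨Polynomial.X - Polynomial.C a, k, by simp, by omega, by rw [← hk]; exact hg0,
        by rw [← hk]; exact hg⟩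
    obtain ⟨P, hP, c, hc⟩ := urep_of_kills (by omega) hg hg0 hgd hnd
    obtain ⟨p0, hp0⟩ := Infinite.exists_notMem_finset P
    obtain ⟨δ, hδ0, hδ, _, hδP⟩ := exists_lin_vanish p0
    refine ⟨δ, hδ0, hδ, fun s hs => ?_⟩
    by_cases hs1 : d1 ≤ s
    · exact ⟨P, hP.trans hs1, c, hc⟩
    exfalso
    obtain ⟨Q, hQ, b, hb⟩ := hs
    obtain ⟨q0, hq0⟩ := Infinite.exists_notMem_finset Q
    obtain ⟨h, hh, hh0, hhQ⟩ := separator Q s q0 hq0 hQ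
    have hk1 := kills_of_vanish hb hh (fun p hp => by rw [hhQ p hp, mul_zero])
    have hdd := Polynomial.natDegree_mul_le (p := δ) (q := h)
    have hk2 : Kills d φ (s + 1) (δ * h) := ⟨by omega, fun q hq => by
      have := hk1.2 q (by omega)
      simp only [LinearMap.comp_apply, LinearMap.mulLeft_apply] at this
      rw [mul_assoc]; exact this⟩
    have hv := dec_vanish hc hk2 (by omega)
    have hk3 := kills_of_vanish hc hh (by
      intro p hp
      have h1 := hv p hp
      rw [ev_mul (n := 1) (m := s) (by omega) p δ h hδ hh] at h1
      rcases mul_eq_zero.mp h1 with h' | h'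
      · rw [h', zero_mul]
      rcases mul_eq_zero.mp h' with h' | h'
      · exact absurd h' (hδP p (by rintro rfl; exact hp0 hp))
      · rw [h', mul_zero])
    have := hmin' s (by omega) h hk3
    rw [this] at hh0
    simp at hh0


/-! ### Bridge to binary forms -/

/-- Exponent of `x^(d-i) y^i`. -/
def expo (d i : ℕ) : Fin 2 →₀ ℕ := Finsupp.single 0 (d - i) + Finsupp.single 1 i

theorem expo_one (d i : ℕ) : expo d i 1 = i := by simp [expo]
theorem expo_zero (d i : ℕ) : expo d i 0 = d - i := by simp [expo]

/-- The binary form `∑ binom(d,i) a_i x^(d-i) y^i`. -/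
def form (d : ℕ) (a : ℕ → ℂ) : MvPolynomial (Fin 2) ℂ :=
  ∑ i ∈ Finset.range (d + 1), monomial (expo d i) ((d.choose i : ℂ) * a i)

theorem monomial_expo (d i : ℕ) (c : ℂ) :
    (monomial (expo d i) c : MvPolynomial (Fin 2) ℂ) = C c * (X 0 ^ (d - i) * X 1 ^ i) := by
  rw [X_pow_eq_monomial, X_pow_eq_monomial, monomial_mul, C_mul_monomial]
  simp [expo]

theorem form_eq (d : ℕ) (a : ℕ → ℂ) :
    form d a = ∑ i ∈ Finset.range (d + 1),
      C ((d.choose i : ℂ) * a i) * (X 0 ^ (d - i) * X 1 ^ i) := by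
  simp only [form, monomial_expo]

theorem coeff_form (d : ℕ) (a : ℕ → ℂ) (i : ℕ) (hi : i ≤ d) :
    coeff (expo d i) (form d a) = (d.choose i : ℂ) * a i := by
  classical
  rw [form, coeff_sum, Finset.sum_eq_single i]
  · rw [coeff_monomial, if_pos rfl]
  · intro j _ hj
    rw [coeff_monomial, if_neg]
    intro h
    apply hj
    rw [← expo_one d j, h, expo_one]
  · intro h; exact absurd (Finset.mem_range.mpr (by omega)) h

theorem form_congr {d : ℕ} {a b : ℕ → ℂ} (h : ∀ i ≤ d, a i = b i) : form d a = form d b := by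
  refine Finset.sum_congr rfl fun i hi => ?_
  rw [Finset.mem_range] at hi
  rw [h i (by omega)]

theorem form_inj {d : ℕ} {a b : ℕ → ℂ} (h : form d a = form d b) : ∀ i ≤ d, a i = b i := by
  intro i hi
  have h1 := coeff_form d a i hi
  rw [h, coeff_form d b i hi] at h1
  have : (d.choose i : ℂ) ≠ 0 := by exact_mod_cast (Nat.choose_pos hi).ne'
  exact (mul_left_cancel₀ this h1).symm

theorem form_sum {ι : Type*} (d : ℕ) (s : Finset ι) (a : ι → ℕ → ℂ) :
    ∑ j ∈ s, form d (a j) = form d (fun i => ∑ j ∈ s, a j i) := by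
  simp only [form]
  rw [Finset.sum_comm]
  refine Finset.sum_congr rfl fun i _ => ?_
  rw [Finset.mul_sum, map_sum]

theorem exists_form {d : ℕ} {F : MvPolynomial (Fin 2) ℂ} (hF : F.IsHomogeneous d) :
    ∃ a, F = form d a := by
  classical
  refine ⟨fun i => coeff (expo d i) F / (d.choose i : ℂ), ?_⟩
  ext m
  by_cases hm : m 0 + m 1 = d
  · have : m = expo d (m 1) := by
      ext j
      fin_cases j
      · simp [expo_zero]; omega
      · simp [expo_one]
    rw [this, coeff_form _ _ _ (by omega)]
    have : (d.choose (m 1) : ℂ) ≠ 0 := by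
      exact_mod_cast (Nat.choose_pos (by omega : m 1 ≤ d)).ne'
    field_simp
  · rw [hF.coeff_eq_zero (d := m) (by
      rw [Finsupp.degree_eq_sum, Fin.sum_univ_two]; exact hm), form, coeff_sum]
    symm
    refine Finset.sum_eq_zero fun i hi => ?_
    rw [Finset.mem_range] at hi
    rw [coeff_monomial, if_neg]
    rintro rfl
    rw [expo_zero, expo_one] at hm
    omega

theorem lin_two (L : Fin 2 → ℂ) : lin L = C (L 0) * X 0 + C (L 1) * X 1 := by
  simp [lin, Fin.sum_univ_two]

theorem lin_pow (d : ℕ) (L : Fin 2 → ℂ) :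
    lin L ^ d = form d (fun i => L 0 ^ (d - i) * L 1 ^ i) := by
  rw [lin_two, add_comm, add_pow, form_eq]
  refine Finset.sum_congr rfl fun i _ => ?_
  simp only [C_mul, C_pow, mul_pow, map_natCast]
  ring

theorem decomp_iff (d : ℕ) (a : ℕ → ℂ) (r : ℕ) : HasWaringDecomp d (form d a) r ↔
    ∃ L : Fin r → Fin 2 → ℂ, ∀ i ≤ d, a i = ∑ j, L j 0 ^ (d - i) * L j 1 ^ i := by
  unfold HasWaringDecomp
  refine exists_congr fun L => ?_
  simp only [lin_pow, form_sum]
  exact ⟨fun h => form_inj h, fun h => form_congr h⟩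

theorem decomp_succ {d r : ℕ} {F : MvPolynomial (Fin 2) ℂ} (h : HasWaringDecomp d F r)
    (v : Fin 2 → ℂ) : HasWaringDecomp d (lin v ^ d + F) (r + 1) := by
  obtain ⟨L, rfl⟩ := h
  exact ⟨Fin.cons v L, by simp [Fin.sum_univ_succ]⟩

theorem decomp_mono {d r s : ℕ} (hd : 1 ≤ d) {F : MvPolynomial (Fin 2) ℂ}
    (h : HasWaringDecomp d F r) (hrs : r ≤ s) : HasWaringDecomp d F s := by
  induction s, hrs using Nat.le_induction with
  | base => exact h
  | succ s _ ih =>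
    have := decomp_succ ih 0
    have h0 : lin (0 : Fin 2 → ℂ) = 0 := by simp [lin]
    rwa [h0, zero_pow (by omega), zero_add] at this

theorem decomp_finset {ι : Type*} (d : ℕ) (P : Finset ι) (v : ι → Fin 2 → ℂ) :
    HasWaringDecomp d (∑ p ∈ P, lin (v p) ^ d) P.card := by
  classical
  induction P using Finset.induction_on with
  | empty =>
    rw [Finset.card_empty, Finset.sum_empty]
    exact ⟨Fin.elim0, by simp⟩
  | insert p P hp ih =>
    rw [Finset.sum_insert hp, Finset.card_insert_of_notMem hp]
    exact decomp_succ ih _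

theorem functional_ext {d : ℕ} {φ ψ : Polynomial ℂ →ₗ[ℂ] ℂ}
    (h : ∀ i ≤ d, φ (Polynomial.X ^ i) = ψ (Polynomial.X ^ i)) (q : Polynomial ℂ)
    (hq : q.natDegree ≤ d) : φ q = ψ q := by
  rw [Polynomial.as_sum_range_C_mul_X_pow q, map_sum, map_sum]
  refine Finset.sum_congr rfl fun i hi => ?_
  rw [Finset.mem_range] at hi
  rw [← Polynomial.smul_eq_C_mul, map_smul, map_smul, h i (by omega)]

theorem decomp_iff_urep {d : ℕ} (hd : 1 ≤ d) (φ : Polynomial ℂ →ₗ[ℂ] ℂ) (r : ℕ) :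
    HasWaringDecomp d (form d fun i => φ (Polynomial.X ^ i)) r ↔ URep d φ r := by
  classical
  constructor
  · rw [decomp_iff]
    rintro ⟨L, hL⟩
    let p : Fin r → Option ℂ := fun j => if L j 0 = 0 then none else some (L j 1 / L j 0)
    let k : Fin r → ℂ := fun j => if L j 0 = 0 then L j 1 ^ d else L j 0 ^ d
    have hpk : ∀ j, ∀ i ≤ d, L j 0 ^ (d - i) * L j 1 ^ i = k j * ev d (p j) (Polynomial.X ^ i) := by
      intro j i hi
      by_cases h : L j 0 = 0
      · simp only [p, k, if_pos h, ev_none, Polynomial.coeff_X_pow]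
        rcases hi.eq_or_lt with rfl | hlt
        · simp
        · rw [h, zero_pow (by omega), if_neg (by omega)]; simp
      · simp only [p, k, if_neg h, ev_some, Polynomial.eval_pow, Polynomial.eval_X, div_pow]
        obtain ⟨t, rfl⟩ := Nat.exists_eq_add_of_le hi
        rw [Nat.add_sub_cancel_left, pow_add]
        field_simp
    refine ⟨Finset.univ.image p, Finset.card_image_le.trans (by simp),
      fun x => ∑ j with p j = x, k j, ?_⟩
    intro q hq
    have h1 : φ q = (∑ j, k j • ev d (p j)) q := by
      refine functional_ext (d := d) (fun i hi => ?_) q hq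
      rw [hL i hi]
      simp only [LinearMap.sum_apply, LinearMap.smul_apply, smul_eq_mul]
      exact Finset.sum_congr rfl fun j _ => hpk j i hi
    rw [h1]
    simp only [LinearMap.sum_apply, LinearMap.smul_apply, smul_eq_mul]
    rw [← Finset.sum_fiberwise_of_maps_to (t := Finset.univ.image p) (g := p)
      (fun j hj => Finset.mem_image_of_mem p hj)]
    refine Finset.sum_congr rfl fun x _ => ?_
    rw [Finset.sum_mul]
    refine Finset.sum_congr rfl fun j hj => ?_
    rw [(Finset.mem_filter.mp hj).2]
  · rintro ⟨P, hP, c, hc⟩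
    refine decomp_mono hd ?_ hP
    have hroot : ∀ z : ℂ, ∃ w, w ^ d = z := fun z =>
      IsAlgClosed.exists_pow_nat_eq z (by omega)
    choose w hw using hroot
    let v : Option ℂ → Fin 2 → ℂ := fun p =>
      match p with
      | none => ![0, w (c none)]
      | some a => ![w (c (some a)), w (c (some a)) * a]
    have := decomp_finset d P v
    convert this using 1
    simp only [lin_pow]
    rw [form_sum]
    refine form_congr fun i hi => ?_
    rw [hc _ (by simpa using hi)]
    refine Finset.sum_congr rfl fun p _ => ?_
    cases p with
    | none =>
      simp only [v, ev_none, Polynomial.coeff_X_pow, Matrix.cons_val_zero, Matrix.cons_val_one]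
      rcases hi.eq_or_lt with rfl | hlt
      · simp [hw]
      · rw [zero_pow (by omega), if_neg (by omega)]; simp
    | some a =>
      simp only [v, ev_some, Matrix.cons_val_zero, Matrix.cons_val_one, Polynomial.eval_pow,
        Polynomial.eval_X]
      rw [mul_pow, ← mul_assoc, ← pow_add, Nat.sub_add_cancel hi, hw]

theorem pderiv_form (n : ℕ) (a : ℕ → ℂ) (c : Fin 2 → ℂ) :
    ∑ i, c i • pderiv i (form (n + 1) a) =
      form n (fun i => ((n : ℂ) + 1) * (c 0 * a i + c 1 * a (i + 1))) := by
  have h0 : pderiv 0 (form (n + 1) a) = form n (fun i => ((n : ℂ) + 1) * a i) := by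
    rw [form_eq, form_eq, map_sum, Finset.sum_range_succ]
    have : ∀ k : ℕ, pderiv (0 : Fin 2) ((X 1 : MvPolynomial (Fin 2) ℂ) ^ k) = 0 := by
      intro k; rw [pderiv_pow, pderiv_X_of_ne (by decide)]; simp
    simp only [pderiv_C, pderiv_mul, this, pderiv_pow, pderiv_X_self, zero_mul, zero_add]
    simp only [Nat.sub_self, Nat.cast_zero, zero_mul, mul_zero, add_zero]
    refine Finset.sum_congr rfl fun i hi => ?_
    rw [Finset.mem_range] at hi
    have e := congrArg (fun x : ℕ => (x : ℂ)) (Nat.choose_mul_succ_eq n i)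
    simp only [Nat.cast_mul, Nat.cast_add, Nat.cast_one] at e
    have e' : (C ((n + 1).choose i : ℂ) * ((n + 1 - i : ℕ) : MvPolynomial (Fin 2) ℂ)) =
        C ((n.choose i : ℂ) * ((n : ℂ) + 1)) := by
      rw [e, C_mul, map_natCast, map_natCast]
    rw [show n + 1 - i - 1 = n - i by omega]
    simp only [C_mul] at e' ⊢
    linear_combination (C (a i) * X 0 ^ (n - i) * X 1 ^ i) * e'
  have h1 : pderiv 1 (form (n + 1) a) = form n (fun i => ((n : ℂ) + 1) * a (i + 1)) := by
    rw [form_eq, form_eq, map_sum, Finset.sum_range_succ']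
    have : ∀ k : ℕ, pderiv (1 : Fin 2) ((X 0 : MvPolynomial (Fin 2) ℂ) ^ k) = 0 := by
      intro k; rw [pderiv_pow, pderiv_X_of_ne (by decide)]; simp
    simp only [pderiv_C, pderiv_mul, this, pderiv_pow, pderiv_X_self, zero_mul, zero_add]
    simp only [Nat.cast_zero, zero_mul, mul_zero, add_zero]
    refine Finset.sum_congr rfl fun i hi => ?_
    have e := congrArg (fun x : ℕ => (x : ℂ)) (Nat.add_one_mul_choose_eq n i)
    simp only [Nat.cast_mul, Nat.cast_add, Nat.cast_one] at e
    have e' : (C ((n + 1).choose (i + 1) : ℂ) * ((i + 1 : ℕ) : MvPolynomial (Fin 2) ℂ)) =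
        C (((n : ℂ) + 1) * (n.choose i : ℂ)) := by
      rw [e, C_mul]; simp
    rw [show n + 1 - (i + 1) = n - i by omega, Nat.add_sub_cancel]
    simp only [C_mul] at e' ⊢
    linear_combination (C (a (i + 1)) * X 0 ^ (n - i) * X 1 ^ i) * e'
  rw [Fin.sum_univ_two, h0, h1]
  simp only [form, Finset.smul_sum, smul_monomial, ← Finset.sum_add_distrib, ← map_add]
  refine Finset.sum_congr rfl fun i _ => ?_
  congr 1
  simp only [smul_eq_mul]
  ring

/-- If a square `l^2` is apolar to the form, then it is `L * M^(d-1)`. -/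
theorem form_of_kills_sq {n : ℕ} (φ : Polynomial ℂ →ₗ[ℂ] ℂ) (l : Polynomial ℂ) (hl0 : l ≠ 0)
    (hl : l.natDegree ≤ 1) (hk : Kills (n + 1) φ 2 (l ^ 2)) :
    ∃ L M : Fin 2 → ℂ, form (n + 1) (fun i => φ (Polynomial.X ^ i)) = lin L * lin M ^ n := by
  obtain ⟨β, α, rfl⟩ := Polynomial.exists_eq_X_add_C_of_natDegree_le_one hl
  have hrec : ∀ j, j + 2 ≤ n + 1 → β ^ 2 * φ (Polynomial.X ^ (j + 2)) +
      2 * α * β * φ (Polynomial.X ^ (j + 1)) + α ^ 2 * φ (Polynomial.X ^ j) = 0 := by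
    intro j hj
    have := hk.2 (Polynomial.X ^ j) (by simpa using hj)
    rw [show (Polynomial.C β * Polynomial.X + Polynomial.C α) ^ 2 * Polynomial.X ^ j =
      (β ^ 2) • Polynomial.X ^ (j + 2) + (2 * α * β) • Polynomial.X ^ (j + 1) +
        (α ^ 2) • Polynomial.X ^ j by
      simp only [Polynomial.smul_eq_C_mul, Polynomial.C_mul, Polynomial.C_pow, map_ofNat]; ring,
      map_add, map_add, map_smul, map_smul, map_smul] at this
    simpa using this
  generalize ha : (fun i => φ (Polynomial.X ^ i)) = a
  have hrec' : ∀ j, j + 2 ≤ n + 1 → β ^ 2 * a (j + 2) + 2 * α * β * a (j + 1) + α ^ 2 * a j = 0 := by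
    intro j hj; simpa [← ha] using hrec j hj
  by_cases hβ : β = 0
  · subst hβ
    have hα : α ≠ 0 := by rintro rfl; simp at hl0
    refine ⟨![((n : ℂ) + 1) * a n, a (n + 1)], ![0, 1], ?_⟩
    rw [form_eq, Finset.sum_range_succ, Finset.sum_range_succ, Finset.sum_eq_zero]
    · simp only [lin_two, Matrix.cons_val_zero, Matrix.cons_val_one]
      simp only [Nat.choose_succ_self_right, Nat.choose_self, Nat.sub_self, C_mul, C_0, C_1,
        Nat.add_sub_cancel_left, Nat.cast_add, Nat.cast_one]
      ring
    · intro j hj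
      rw [Finset.mem_range] at hj
      have := hrec' j (by omega)
      have h0 : a j = 0 := by simpa [hα] using this
      simp [h0]
  · obtain ⟨p, hp⟩ : ∃ p, α = -p * β := ⟨-(α / β), by field_simp⟩
    have hr : ∀ j, j + 2 ≤ n + 1 → a (j + 2) = 2 * p * a (j + 1) - p ^ 2 * a j := by
      intro j hj
      have h := hrec' j hj
      rw [hp] at h
      have hb : β ^ 2 ≠ 0 := pow_ne_zero _ hβ
      apply mul_left_cancel₀ hb
      linear_combination h
    have hsol : ∀ j, (j ≤ n + 1 → a j = a 0 * p ^ j + (a 1 - a 0 * p) * (j * p ^ (j - 1))) ∧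
        (j + 1 ≤ n + 1 → a (j + 1) = a 0 * p ^ (j + 1) + (a 1 - a 0 * p) * ((j + 1) * p ^ j)) := by
      intro j
      induction j with
      | zero => constructor <;> intro _ <;> simp
      | succ j ih =>
        refine ⟨fun h => ?_, fun h => ?_⟩
        · rw [ih.2 h]; push_cast; simp
        · rw [hr j (by omega), ih.2 (by omega), ih.1 (by omega)]
          rcases j with _ | j
          · simp; ring
          · push_cast; try simp only [Nat.add_sub_cancel]
            ring
    have key : (X 1 : MvPolynomial (Fin 2) ℂ) * lin ![1, p] ^ n =
        form (n + 1) (fun i => (i * p ^ (i - 1)) / ((n : ℂ) + 1)) := by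
      rw [lin_pow, form_eq, form_eq, Finset.sum_range_succ' _ (n + 1), Finset.mul_sum]
      simp only [Nat.cast_zero, zero_mul, zero_div, mul_zero, C_0, add_zero]
      refine Finset.sum_congr rfl fun i _ => ?_
      have e := congrArg (fun x : ℕ => (x : ℂ)) (Nat.add_one_mul_choose_eq n i)
      simp only [Nat.cast_mul, Nat.cast_add, Nat.cast_one] at e
      have hn : (n : ℂ) + 1 ≠ 0 := by exact_mod_cast Nat.succ_ne_zero n
      have e2 : ((n + 1).choose (i + 1) : ℂ) * (((i + 1 : ℕ) : ℂ) * p ^ (i + 1 - 1) / ((n : ℂ) + 1))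
          = (n.choose i : ℂ) * p ^ i := by
        push_cast
        try simp only [Nat.add_sub_cancel]
        field_simp
        linear_combination -(p ^ i) * e
      rw [e2, show n + 1 - (i + 1) = n - i by omega]
      simp only [Matrix.cons_val_zero, Matrix.cons_val_one, one_pow, one_mul]
      ring
    refine ⟨![a 0, a 0 * p + (n + 1) * (a 1 - a 0 * p)], ![1, p], ?_⟩
    have hL : lin ![a 0, a 0 * p + (n + 1) * (a 1 - a 0 * p)] =
        C (a 0) * lin ![1, p] + C (((n : ℂ) + 1) * (a 1 - a 0 * p)) * X 1 := by
      simp only [lin_two, Matrix.cons_val_zero, Matrix.cons_val_one, C_add, C_mul, C_1]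
      ring
    rw [hL, add_mul, mul_assoc, mul_assoc, key, ← pow_succ', lin_pow]
    simp only [form, Finset.mul_sum, C_mul_monomial, ← Finset.sum_add_distrib, ← map_add]
    refine Finset.sum_congr rfl fun i hi => ?_
    rw [Finset.mem_range] at hi
    congr 1
    have hn : (n : ℂ) + 1 ≠ 0 := by exact_mod_cast Nat.succ_ne_zero n
    rw [(hsol i).1 (by omega)]
    simp only [Matrix.cons_val_zero, Matrix.cons_val_one, one_pow, one_mul]
    field_simp

theorem binary_nonmaximal_rank_has_rank_preserving_derivative
    (d : ℕ) (hd : 2 ≤ d) (F : MvPolynomial (Fin 2) ℂ)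
    (hF : F ≠ 0) (hhom : F.IsHomogeneous d)
    (hmax : ¬ ∃ L M : Fin 2 → ℂ, F = lin L * lin M ^ (d - 1)) :
    ∃ c : Fin 2 → ℂ, c ≠ 0 ∧
      waringRank (d - 1) (∑ i, c i • pderiv i F) = waringRank d F := by
  obtain ⟨a, rfl⟩ := exists_form hhom
  obtain ⟨φ, hφ⟩ : ∃ φ : Polynomial ℂ →ₗ[ℂ] ℂ, ∀ i, φ (Polynomial.X ^ i) = a i := by
    refine ⟨(Polynomial.basisMonomials ℂ).constr ℂ a, fun i => ?_⟩
    have := (Polynomial.basisMonomials ℂ).constr_basis ℂ a i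
    simpa only [Polynomial.coe_basisMonomials, Polynomial.monomial_one_right_eq_X_pow] using this
  obtain rfl : (fun i => φ (Polynomial.X ^ i)) = a := funext hφ
  obtain ⟨n, rfl⟩ : ∃ n, d = n + 1 := ⟨d - 1, by omega⟩
  rw [Nat.add_sub_cancel] at hmax ⊢
  obtain ⟨l, hl0, hl, hs⟩ := umain hd φ (by
    by_contra! hcon
    apply hF
    rw [form]
    refine Finset.sum_eq_zero fun i hi => ?_
    rw [Finset.mem_range] at hi
    rw [hcon _ (by simp; omega)]
    simp) (fun l h0 h1 hk => hmax (form_of_kills_sq φ l h0 h1 hk))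
  rw [Nat.add_sub_cancel] at hs
  have hn : (n : ℂ) + 1 ≠ 0 := by exact_mod_cast Nat.succ_ne_zero n
  have hle := Polynomial.eq_X_add_C_of_natDegree_le_one hl
  refine ⟨![l.coeff 0 / ((n : ℂ) + 1), l.coeff 1 / ((n : ℂ) + 1)], ?_, ?_⟩
  · intro h
    have h0 := congrFun h 0
    have h1 := congrFun h 1
    simp [hn] at h0 h1
    apply hl0
    rw [hle, h0, h1]; simp
  · have hform : ∑ i, (![l.coeff 0 / ((n : ℂ) + 1), l.coeff 1 / ((n : ℂ) + 1)] : Fin 2 → ℂ) i •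
        pderiv i (form (n + 1) fun i => φ (Polynomial.X ^ i)) =
        form n (fun i => (φ ∘ₗ LinearMap.mulLeft ℂ l) (Polynomial.X ^ i)) := by
      rw [pderiv_form]
      refine form_congr fun i _ => ?_
      simp only [LinearMap.comp_apply, LinearMap.mulLeft_apply, Matrix.cons_val_zero,
        Matrix.cons_val_one]
      have : l * Polynomial.X ^ i = l.coeff 0 • Polynomial.X ^ i +
          l.coeff 1 • Polynomial.X ^ (i + 1) := by
        conv_lhs => rw [hle]
        simp only [Polynomial.smul_eq_C_mul]; ring
      rw [this, map_add, map_smul, map_smul, smul_eq_mul, smul_eq_mul]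
      field_simp
    rw [hform]
    unfold waringRank
    congr 1
    ext s
    simp only [Set.mem_ofPred_eq]
    rw [decomp_iff_urep (by omega), decomp_iff_urep (by omega)]
    refine ⟨hs s, ?_⟩
    rintro ⟨P, hP, c, hc⟩
    refine ⟨P, hP, fun p => c p * ev 1 p l, fun q hq => ?_⟩
    have hdeg := Polynomial.natDegree_mul_le (p := l) (q := q)
    simp only [LinearMap.comp_apply, LinearMap.mulLeft_apply]
    rw [hc (l * q) (by omega)]
    refine Finset.sum_congr rfl fun p _ => ?_
    rw [ev_mul (n := 1) (m := n) (by omega) p l q hl hq, mul_assoc]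

end
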